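/- Let a : ℕ → ℝ be nonnegative and summable, N(τ) := ∑'_j a_j/(a_j+τ), σ > 0, α, β ∈ (0,1), x_α := log(1/α), x_β := log(1/β), and C_{α,β} := 4√(x_β) + 4√(2x_α) + 4x_α + 8x_β. Let φ be nonnegative nondecreasing, Θ(u) := √u·φ(u), and let (g_τ)_{τ>0} satisfy t·|g_τ(t)| ≤ γ₀ and τ·|g_τ(t)| ≤ γ_* for all t ≥ 0, τ > 0, together with the qualification-Θ bound |1 − t·g_τ(t)|·√t·φ(t) ≤ γ·Θ(τ) for all t ≥ 0, τ > 0. Let f be given in eigencoordinates by f_j = φ(a_j)·ω_j with ∑_j ω_j² ≤ 1. Define S̃_τ² := σ²·∑'_j (g_τ(a_j)·a_j)², ṽ_τ² := σ²·sup_j (g_τ(a_j)·a_j)², and b̃ias²(τ) := ∑'_j a_j·(1 − a_j·g_τ(a_j))²·φ(a_j)²·ω_j² (= ‖Tf − Tf_τ‖²). If τ_* > 0 satisfies σ² = Θ²(τ_*)/√(N(τ_*)), then inf_{τ>0} ( C_{α,β}·S̃_τ·ṽ_τ + b̃ias²(τ) ) ≤ ( C_{α,β}·√((γ₀+γ_*)·γ₀)·γ₀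 + γ² )·Θ²(τ_*). (This is the separation-radius bound for the direct testing problem H₀: Tf = 0 based on the reconstruction g_τ(TT*)TT*Y, with parameter τ_* determined by the same balance equation as for the inverse problem.) -/

import Mathlib

/-- The terms `a j / (a j + τ)` of the effective dimension are summable. -/
lemma summable_div_add_const {a : ℕ → ℝ} (ha : ∀ j, 0 ≤ a j) (hsum : Summable a)
    {τ : ℝ} (hτ : 0 < τ) : Summable fun j => a j / (a j + τ) :=
  (hsum.div_const τ).of_nonneg_of_le (fun j => div_nonneg (ha j) (add_nonneg (ha j) hτ.le))
    fun j => div_le_div_of_nonneg_left (ha j) hτ (le_add_of_nonneg_left (ha j))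

/-- A filter value `y` with `t |y| ≤ γ₀` and `τ |y| ≤ γs` satisfies
`(y t)² ≤ (γ₀ + γs) γ₀ t / (t + τ)`. -/
lemma sq_filter_le {t τ y γ₀ γs : ℝ} (ht : 0 ≤ t) (hτ : 0 < τ)
    (h₀ : t * |y| ≤ γ₀) (hs : τ * |y| ≤ γs) :
    (y * t) ^ 2 ≤ (γ₀ + γs) * γ₀ * (t / (t + τ)) := by
  have hpos : 0 < t + τ := by linarith
  have hle : t * |y| ≤ (γ₀ + γs) * (t / (t + τ)) := by
    rw [← mul_div_assoc, le_div_iff₀ hpos]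
    nlinarith
  have hnn : 0 ≤ t * |y| := by positivity
  calc (y * t) ^ 2 = (t * |y|) * (t * |y|) := by rw [← sq, mul_pow, mul_pow, sq_abs, mul_comm]
    _ ≤ ((γ₀ + γs) * (t / (t + τ))) * γ₀ := mul_le_mul hle h₀ hnn (hnn.trans hle)
    _ = _ := by ring

/-- A filter value `y` with `t |y| ≤ γ₀` satisfies `(y t)² ≤ γ₀²`. -/
lemma sq_filter_le_sq {t y γ₀ : ℝ} (ht : 0 ≤ t) (h₀ : t * |y| ≤ γ₀) :
    (y * t) ^ 2 ≤ γ₀ ^ 2 := by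
  rw [← sq_abs, abs_mul, abs_of_nonneg ht, mul_comm]
  exact pow_le_pow_left₀ (by positivity) h₀ 2

/-- Squared qualification bound: the weight of a coefficient in the squared bias. -/
lemma bias_weight_le_sq {t y p c : ℝ} (ht : 0 ≤ t) (hp : 0 ≤ p)
    (h : |1 - t * y| * (Real.sqrt t * p) ≤ c) :
    t * (1 - t * y) ^ 2 * p ^ 2 ≤ c ^ 2 := by
  calc t * (1 - t * y) ^ 2 * p ^ 2 = (|1 - t * y| * (Real.sqrt t * p)) ^ 2 := by
        rw [mul_pow, mul_pow, sq_abs, Real.sq_sqrt ht]; ring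
    _ ≤ c ^ 2 := pow_le_pow_left₀ (by positivity) h 2

/-- Separation-radius bound for the direct testing problem `H₀ : Tf = 0` based on
the reconstruction `g_τ(TT*)TT*Y`: with `S̃_τ² = σ² ∑' (g_τ(a_j) a_j)²`,
`ṽ_τ² = σ² sup_j (g_τ(a_j) a_j)²`, direct bias
`∑' a_j (1 − a_j g_τ(a_j))² φ(a_j)² ω_j²` and `Θ(u) = √u φ(u)`, if `τ_*` solves
`σ² = Θ²(τ_*)/√(N(τ_*))` then
`inf_{τ>0} (C_{α,β} S̃_τ ṽ_τ + bias²(τ)) ≤ (C_{α,β} √((γ₀+γ_*)γ₀) γ₀ + γ²) Θ²(τ_*)`. -/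
theorem stmt_18
    (a : ℕ → ℝ) (ha : ∀ j, 0 ≤ a j) (hsum : Summable a)
    (σ : ℝ) (hσ : 0 < σ)
    (α β : ℝ) (hα : α ∈ Set.Ioo (0 : ℝ) 1) (hβ : β ∈ Set.Ioo (0 : ℝ) 1)
    (xα xβ Cab : ℝ) (hxα : xα = Real.log (1 / α)) (hxβ : xβ = Real.log (1 / β))
    (hCab : Cab = 4 * Real.sqrt xβ + 4 * Real.sqrt (2 * xα) + 4 * xα + 8 * xβ)
    (φ : ℝ → ℝ) (hφ0 : ∀ t, 0 ≤ φ t) (hφmono : Monotone φ)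
    (Θ : ℝ → ℝ) (hΘ : ∀ u, Θ u = Real.sqrt u * φ u)
    (g : ℝ → ℝ → ℝ) (γ₀ γs γ : ℝ) (hγ₀ : 0 < γ₀) (hγs : 0 < γs) (hγ : 0 < γ)
    (hg : ∀ τ : ℝ, 0 < τ → ∀ t : ℝ, 0 ≤ t →
      t * |g τ t| ≤ γ₀ ∧ τ * |g τ t| ≤ γs)
    (hqual : ∀ τ : ℝ, 0 < τ → ∀ t : ℝ, 0 ≤ t →
      |1 - t * g τ t| * (Real.sqrt t * φ t) ≤ γ * Θ τ)
    (ω : ℕ → ℝ) (hω : Summable fun j => ω j ^ 2) (hω1 : (∑' j, ω j ^ 2) ≤ 1)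
    (N St vt bias2 : ℝ → ℝ)
    (hN : ∀ τ, N τ = ∑' j, a j / (a j + τ))
    (hSt : ∀ τ, St τ = Real.sqrt (σ ^ 2 * ∑' j, (g τ (a j) * a j) ^ 2))
    (hvt : ∀ τ, vt τ = Real.sqrt (σ ^ 2 * ⨆ j, (g τ (a j) * a j) ^ 2))
    (hbias2 : ∀ τ, bias2 τ =
      ∑' j, a j * (1 - a j * g τ (a j)) ^ 2 * φ (a j) ^ 2 * ω j ^ 2)
    (τs : ℝ) (hτs : 0 < τs)
    (hbal : σ ^ 2 = Θ τs ^ 2 / Real.sqrt (N τs)) :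
    (⨅ τ : Set.Ioi (0 : ℝ), (Cab * St τ * vt τ + bias2 τ)) ≤
      (Cab * Real.sqrt ((γ₀ + γs) * γ₀) * γ₀ + γ ^ 2) * Θ τs ^ 2 := by
  have hC : 0 ≤ Cab := by
    have hlog : ∀ x ∈ Set.Ioo (0 : ℝ) 1, 0 ≤ Real.log (1 / x) := fun x hx =>
      Real.log_nonneg ((one_le_div hx.1).2 hx.2.le)
    have hxα0 : 0 ≤ xα := hxα ▸ hlog α hα
    have hxβ0 : 0 ≤ xβ := hxβ ▸ hlog β hβ
    rw [hCab]
    positivity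
  have hbias_nonneg : ∀ τ, 0 ≤ bias2 τ := fun τ => by
    rw [hbias2]
    refine tsum_nonneg fun j => ?_
    have := ha j
    positivity
  have hSt_nonneg : ∀ τ, 0 ≤ St τ := fun τ => hSt τ ▸ Real.sqrt_nonneg _
  have hvt_nonneg : ∀ τ, 0 ≤ vt τ := fun τ => hvt τ ▸ Real.sqrt_nonneg _
  have hbdd : BddBelow (Set.range fun τ : Set.Ioi (0 : ℝ) =>
      Cab * St τ * vt τ + bias2 τ) := by
    refine ⟨0, ?_⟩
    rintro _ ⟨τ, rfl⟩
    exact add_nonneg (mul_nonneg (mul_nonneg hC (hSt_nonneg τ)) (hvt_nonneg τ))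
      (hbias_nonneg τ)
  refine (ciInf_le hbdd ⟨τs, hτs⟩).trans ?_
  change Cab * St τs * vt τs + bias2 τs ≤ _
  have hNpos : 0 < Real.sqrt (N τs) := by
    refine (Real.sqrt_nonneg _).lt_of_ne' fun h => ?_
    rw [h, div_zero] at hbal
    exact (pow_pos hσ 2).ne' hbal
  have hbal' : σ ^ 2 * Real.sqrt (N τs) = Θ τs ^ 2 := by
    rw [hbal, div_mul_cancel₀ _ hNpos.ne']
  have hK : 0 ≤ (γ₀ + γs) * γ₀ := by positivity
  have hsumK := (summable_div_add_const ha hsum hτs).mul_left ((γ₀ + γs) * γ₀)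
  have hsq : ∀ j, (g τs (a j) * a j) ^ 2 ≤ (γ₀ + γs) * γ₀ * (a j / (a j + τs)) := fun j =>
    sq_filter_le (ha j) hτs (hg τs hτs _ (ha j)).1 (hg τs hτs _ (ha j)).2
  have hS : St τs ≤ σ * (Real.sqrt ((γ₀ + γs) * γ₀) * Real.sqrt (N τs)) := by
    rw [hSt, Real.sqrt_mul (sq_nonneg σ), Real.sqrt_sq hσ.le, ← Real.sqrt_mul hK, hN,
      ← tsum_mul_left]
    refine mul_le_mul_of_nonneg_left (Real.sqrt_le_sqrt ?_) hσ.le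
    exact (hsumK.of_nonneg_of_le (fun j => sq_nonneg _) hsq).tsum_le_tsum hsq hsumK
  have hv : vt τs ≤ σ * γ₀ := by
    rw [hvt, Real.sqrt_mul (sq_nonneg σ), Real.sqrt_sq hσ.le]
    refine mul_le_mul_of_nonneg_left (Real.sqrt_le_iff.2 ⟨hγ₀.le, ?_⟩) hσ.le
    exact ciSup_le fun j => sq_filter_le_sq (ha j) (hg τs hτs _ (ha j)).1
  have hSv : St τs * vt τs ≤ Real.sqrt ((γ₀ + γs) * γ₀) * γ₀ * Θ τs ^ 2 := by
    refine (mul_le_mul hS hv (hvt_nonneg _) (by positivity)).trans_eq ?_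
    rw [← hbal']
    ring
  have hterm : ∀ j, a j * (1 - a j * g τs (a j)) ^ 2 * φ (a j) ^ 2 * ω j ^ 2 ≤
      (γ * Θ τs) ^ 2 * ω j ^ 2 := fun j =>
    mul_le_mul_of_nonneg_right
      (bias_weight_le_sq (ha j) (hφ0 _) (hqual τs hτs _ (ha j))) (sq_nonneg _)
  have hb : bias2 τs ≤ γ ^ 2 * Θ τs ^ 2 := by
    have hsumω := hω.mul_left ((γ * Θ τs) ^ 2)
    have hsumb := hsumω.of_nonneg_of_le (fun j => by have := ha j; positivity) hterm
    rw [hbias2, ← mul_pow]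
    refine (hsumb.tsum_le_tsum hterm hsumω).trans ?_
    rw [tsum_mul_left]
    exact mul_le_of_le_one_right (sq_nonneg _) hω1
  calc Cab * St τs * vt τs + bias2 τs = Cab * (St τs * vt τs) + bias2 τs := by ring
    _ ≤ Cab * (Real.sqrt ((γ₀ + γs) * γ₀) * γ₀ * Θ τs ^ 2) + γ ^ 2 * Θ τs ^ 2 :=
      add_le_add (mul_le_mul_of_nonneg_left hSv hC) hb
    _ = _ := by ring
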